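/- Let S be a closed surface with a fixed metric inducing its topology and let K be a nonempty compact subset of S. Then for every x ∈ K there exists a connected set N_x with R_K(x) ⊆ N_x ⊆ [x]_∼, where R_K(x) = {y ∈ K : (x,y) ∈ R_K} is the fiber of the Schönflies relation at x and [x]_∼ is the class of x under the Schönflies equivalence. -/

import Mathlib

open Set Metric Filter Topology unitInterval

/-- A space is locally euclidean of dimension 2 if every point has an open neighborhood
homeomorphic to `ℝ²`. A *closed surface* is a nonempty compact connected Hausdorff space
with this property. -/
def IsSurfaceLocallyEuclidean (S : Type*) [TopologicalSpace S] : Prop :=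
  ∀ x : S, ∃ U : Set S, IsOpen U ∧ x ∈ U ∧ Nonempty (U ≃ₜ (ℝ × ℝ))

/-- The Schönflies relation of a compact set `K` on a (metric) surface `S`: pairs `(x, x)`
with `x ∈ K`, together with pairs of distinct points `x, y ∈ K` for which there is a
topological embedding `φ` of the square `[0,1]²` into `S` (a marked quadrilateral with
marked sides `I₁ = φ([0,1]×{0})` and `I₂ = φ([0,1]×{1})`) such that
(a) `x ∈ I₁`, `y ∈ I₂` and `K ∩ ∂Q ⊆ I₁ ∪ I₂`;
(b) `K ∩ Q` has infinitely many pairwise distinct connected components `Qₙ`, each meeting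
both `I₁` and `I₂`;
(c) the sequence `(Qₙ)` converges in the Hausdorff metric to a continuum `Q∞` containing
both `x` and `y`. -/
def schonfliesRel {S : Type*} [MetricSpace S] (K : Set S) : Set (S × S) :=
  {p | p.1 ∈ K ∧ p.2 ∈ K ∧ (p.1 = p.2 ∨
    ∃ φ : unitInterval × unitInterval → S, Topology.IsEmbedding φ ∧
      p.1 ∈ φ '' {q | q.2 = 0} ∧ p.2 ∈ φ '' {q | q.2 = 1} ∧
      K ∩ (φ '' {q | q.1 = 0 ∨ q.1 = 1 ∨ q.2 = 0 ∨ q.2 = 1}) ⊆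
        (φ '' {q | q.2 = 0}) ∪ (φ '' {q | q.2 = 1}) ∧
      ∃ Q : ℕ → Set S,
        (∀ m n, m ≠ n → Q m ≠ Q n) ∧
        (∀ n, ∃ z ∈ K ∩ Set.range φ, Q n = connectedComponentIn (K ∩ Set.range φ) z) ∧
        (∀ n, (Q n ∩ φ '' {q | q.2 = 0}).Nonempty ∧ (Q n ∩ φ '' {q | q.2 = 1}).Nonempty) ∧
        ∃ Qinf : Set S, IsCompact Qinf ∧ IsConnected Qinf ∧
          Filter.Tendsto (fun n => Metric.hausdorffDist (Q n) Qinf) Filter.atTop (nhds 0) ∧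
          p.1 ∈ Qinf ∧ p.2 ∈ Qinf)}

/-- The collection of closed equivalence relations on `K` containing a given relation `R`. -/
def closedEquivsOn {S : Type*} [MetricSpace S] (K : Set S) (R : Set (S × S)) :
    Set (Set (S × S)) :=
  {E | R ⊆ E ∧ E ⊆ K ×ˢ K ∧ IsClosed E ∧ (∀ x ∈ K, (x, x) ∈ E) ∧
    (∀ x y, (x, y) ∈ E → (y, x) ∈ E) ∧
    (∀ x y z, (x, y) ∈ E → (y, z) ∈ E → (x, z) ∈ E)}

/-- The Schönflies equivalence `∼_K`: the smallest closed equivalence relation on `K`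
containing the Schönflies relation `R_K`. -/
def schonfliesEquiv {S : Type*} [MetricSpace S] (K : Set S) : Set (S × S) :=
  ⋂₀ closedEquivsOn K (schonfliesRel K)

/-- The Schönflies class `[x]_∼` of a point `x`. -/
def schonfliesClass {S : Type*} [MetricSpace S] (K : Set S) (x : S) : Set S :=
  {y | (x, y) ∈ schonfliesEquiv K}

/-- The decomposition `D_K = {[x]_∼ : x ∈ K}` of `K` into Schönflies classes. -/
def schonfliesDecomp {S : Type*} [MetricSpace S] (K : Set S) : Set (Set S) :=
  {C | ∃ x ∈ K, C = schonfliesClass K x}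


lemma angle_edge (a : ℝ → ℝ) (ha : ContinuousOn a (Icc 0 1)) (c : ℝ)
    (h : ∀ t ∈ Icc (0:ℝ) 1, 0 ≤ Real.sin (a t - c)) (p q : ℝ) (hp : p ∈ Icc (0:ℝ) 1)
    (hq : q ∈ Icc (0:ℝ) 1) (h0 : a p ∈ Icc c (c + Real.pi)) :
    a q ∈ Icc c (c + Real.pi) := by
  have hpi := Real.pi_pos
  have hI : IsPreconnected (a '' Icc 0 1) := isPreconnected_Icc.image a ha
  have hoc := hI.ordConnected
  by_contra hcon
  rw [mem_Icc, not_and_or, not_le, not_le] at hcon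
  rcases hcon with hcon | hcon
  · have : max (a q) (c - Real.pi/2) ∈ a '' Icc 0 1 := by
      apply hoc.out (mem_image_of_mem a hq) (mem_image_of_mem a hp)
      refine ⟨le_max_left _ _, max_le ?_ ?_⟩ <;> linarith [h0.1]
    obtain ⟨t, ht, hte⟩ := this
    have h1 := h t ht
    rw [hte] at h1
    have : Real.sin (max (a q) (c - Real.pi/2) - c) < 0 := by
      apply Real.sin_neg_of_neg_of_neg_pi_lt
      · have : max (a q) (c - Real.pi/2) < c := max_lt hcon (by linarith)
        linarith
      · have := le_max_right (a q) (c - Real.pi/2)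
        linarith
    linarith
  · have : min (a q) (c + 3 * Real.pi/2) ∈ a '' Icc 0 1 := by
      apply hoc.out (mem_image_of_mem a hp) (mem_image_of_mem a hq)
      refine ⟨le_min ?_ ?_, min_le_left _ _⟩ <;> linarith [h0.2]
    obtain ⟨t, ht, hte⟩ := this
    have h1 := h t ht
    rw [hte] at h1
    have : Real.sin (min (a q) (c + 3 * Real.pi/2) - c - Real.pi) > 0 := by
      apply Real.sin_pos_of_pos_of_lt_pi
      · have : c + Real.pi < min (a q) (c + 3*Real.pi/2) := lt_min hcon (by linarith)
        linarith
      · have := min_le_right (a q) (c + 3*Real.pi/2)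
        linarith
    rw [Real.sin_sub_pi] at this
    linarith

lemma angle_corner (a c : ℝ) (h0 : a ∈ Icc c (c + Real.pi))
    (h : 0 ≤ Real.sin (a - (c + Real.pi/2))) :
    a ∈ Icc (c + Real.pi/2) ((c + Real.pi/2) + Real.pi) := by
  have hpi := Real.pi_pos
  refine ⟨?_, by linarith [h0.2]⟩
  by_contra hcon
  have : Real.sin (a - (c + Real.pi/2)) < 0 := by
    apply Real.sin_neg_of_neg_of_neg_pi_lt <;> linarith [h0.1]
  linarith

lemma crossing (γ η : ℝ → ℝ × ℝ) (hγ : Continuous γ) (hη : Continuous η)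
    (hne : ∀ s t, γ s ≠ η t)
    (h0 : ∀ t, (γ 0).1 ≤ (η t).1) (h1 : ∀ t, (η t).1 ≤ (γ 1).1)
    (h2 : ∀ s, (η 0).2 ≤ (γ s).2) (h3 : ∀ s, (γ s).2 ≤ (η 1).2) : False := by
  have hpi := Real.pi_pos
  let F : C(ℝ × ℝ, ℂ) := ⟨fun p => Complex.equivRealProdCLM.symm (γ p.1 - η p.2), by fun_prop⟩
  have hF : ∀ p, F p ≠ 0 := by
    intro p hp
    have : γ p.1 - η p.2 = 0 :=
      (map_eq_zero_iff _ Complex.equivRealProdCLM.symm.injective).1 hp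
    exact hne _ _ (sub_eq_zero.1 this)
  obtain ⟨G, hG, -⟩ := Complex.isCoveringMapOn_exp.existsUnique_continuousMap_lifts (A := ℝ × ℝ)
    (f := F) (a₀ := (0,0)) (e₀ := Complex.log (F (0,0))) (by
      rw [Complex.exp_log (hF _)]) (by
      intro p; exact hF p)
  have hG' : ∀ p, Complex.exp (G p) = F p := fun p => congrFun hG.2 p
  let a : ℝ → ℝ → ℝ := fun s t => (G (s,t)).im
  have hre : ∀ s t, (γ s).1 - (η t).1 = Real.exp (G (s,t)).re * Real.cos (a s t) := by
    intro s t
    have := congrArg Complex.re (hG' (s,t))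
    rw [Complex.exp_re] at this
    rw [this]; simp [F]
  have him : ∀ s t, (γ s).2 - (η t).2 = Real.exp (G (s,t)).re * Real.sin (a s t) := by
    intro s t
    have := congrArg Complex.im (hG' (s,t))
    rw [Complex.exp_im] at this
    rw [this]; simp [F]
  have c0 : ∀ t, Real.cos (a 0 t) ≤ 0 := by
    intro t
    by_contra hc
    have := mul_pos (Real.exp_pos (G (0,t)).re) (not_le.1 hc)
    linarith [hre 0 t, h0 t]
  have c1 : ∀ t, 0 ≤ Real.cos (a 1 t) := by
    intro t
    by_contra hc
    have := mul_neg_of_pos_of_neg (Real.exp_pos (G (1,t)).re) (not_le.1 hc)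
    linarith [hre 1 t, h1 t]
  have s0 : ∀ s, 0 ≤ Real.sin (a s 0) := by
    intro s
    by_contra hc
    have := mul_neg_of_pos_of_neg (Real.exp_pos (G (s,0)).re) (not_le.1 hc)
    linarith [him s 0, h2 s]
  have s1 : ∀ s, Real.sin (a s 1) ≤ 0 := by
    intro s
    by_contra hc
    have := mul_pos (Real.exp_pos (G (s,1)).re) (not_le.1 hc)
    linarith [him s 1, h3 s]
  have ca : Continuous (fun p : ℝ × ℝ => a p.1 p.2) := Complex.continuous_im.comp G.continuous
  have hk : ∃ k : ℤ, a 0 0 - Real.pi/2 - k * (2*Real.pi) ∈ Ico 0 (2*Real.pi) := by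
    obtain ⟨k, hk, -⟩ := existsUnique_sub_zsmul_mem_Ico (a := 2*Real.pi) (by positivity) (a 0 0 - Real.pi/2) 0
    exact ⟨k, by simpa using hk⟩
  obtain ⟨k, hk⟩ := hk
  set c := Real.pi/2 + k * (2*Real.pi) with hc
  have e1 : ∀ x, Real.sin (x - c) = - Real.cos x := by
    intro x
    rw [hc, ← sub_sub, Real.sin_sub_int_mul_two_pi, Real.sin_sub_pi_div_two]
  have e2 : ∀ x, Real.sin (x - (c + Real.pi/2)) = - Real.sin x := by
    intro x
    rw [show x - (c + Real.pi/2) = (x - Real.pi/2) - c by ring, e1, Real.cos_sub_pi_div_two]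
  have e3 : ∀ x, Real.sin (x - (c + Real.pi/2 + Real.pi/2)) = Real.cos x := by
    intro x
    rw [show x - (c + Real.pi/2 + Real.pi/2) = (x - Real.pi/2) - (c + Real.pi/2) by ring, e2, Real.sin_sub_pi_div_two]
    ring
  have e4 : ∀ x, Real.sin (x - (c + Real.pi/2 + Real.pi/2 + Real.pi/2)) = Real.sin x := by
    intro x
    rw [show x - (c + Real.pi/2 + Real.pi/2 + Real.pi/2) = (x - Real.pi/2) - (c + Real.pi/2 + Real.pi/2) by ring, e3, Real.cos_sub_pi_div_two]
  have z0 : (0:ℝ) ∈ Icc (0:ℝ) 1 := by simp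
  have z1 : (1:ℝ) ∈ Icc (0:ℝ) 1 := by simp
  have st : a 0 0 ∈ Icc c (c + Real.pi) := by
    refine ⟨by linarith [hk.1], ?_⟩
    by_contra hcon
    have : 0 < Real.sin (a 0 0 - c - Real.pi) := by
      apply Real.sin_pos_of_pos_of_lt_pi <;> linarith [hk.2]
    rw [Real.sin_sub_pi, e1] at this
    linarith [c0 0]
  have p1 := angle_edge (fun t => a 0 t) (by fun_prop) c (fun t _ => by rw [e1]; linarith [c0 t]) 0 1 z0 z1 st
  have p2 := angle_corner _ _ p1 (by rw [e2]; linarith [s1 0])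
  have p3 := angle_edge (fun s => a s 1) (by fun_prop) _ (fun t _ => by rw [e2]; linarith [s1 t]) 0 1 z0 z1 p2
  have p4 := angle_corner _ _ p3 (by rw [e3]; linarith [c1 1])
  have p5 := angle_edge (fun t => a 1 t) (by fun_prop) _ (fun t _ => by rw [e3]; linarith [c1 t]) 1 0 z1 z0 p4
  have p6 := angle_corner _ _ p5 (by rw [e4]; linarith [s0 1])
  have p7 := angle_edge (fun s => a s 0) (by fun_prop) _ (fun t _ => by rw [e4]; linarith [s0 t]) 1 0 z1 z0 p6
  have p8 := p7.1
  have p9 := st.2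
  have : a 0 0 = c + Real.pi := by linarith
  have h5 := s0 0
  have h6 := e2 (a 0 0)
  rw [this, show c + Real.pi - (c+Real.pi/2) = Real.pi/2 by ring, Real.sin_pi_div_two, ← this] at h6
  linarith


lemma exists_homeo_ball (p q : ℝ × ℝ) (r : ℝ) (h : dist q p < r) :
    ∃ e : (ℝ × ℝ) ≃ₜ (ℝ × ℝ), e p = q ∧ ∀ x, x ∉ ball p r → e x = x := by
  have hr : 0 < r := lt_of_le_of_lt dist_nonneg h
  let f : ℝ × ℝ → ℝ × ℝ := fun x => x + (max 0 (1 - dist x p / r)) • (q - p)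
  let c : NNReal := ⟨dist q p / r, by positivity⟩
  have hf : ApproximatesLinearOn f
      ((ContinuousLinearEquiv.refl ℝ (ℝ × ℝ) : (ℝ × ℝ) ≃L[ℝ] (ℝ × ℝ)) : (ℝ × ℝ) →L[ℝ] (ℝ × ℝ)) univ c := by
    intro x _ y _
    have e1 : f x - f y - ((ContinuousLinearEquiv.refl ℝ (ℝ × ℝ) : (ℝ × ℝ) ≃L[ℝ] (ℝ × ℝ)) : (ℝ × ℝ) →L[ℝ] (ℝ × ℝ)) (x - y)
        = (max 0 (1 - dist x p / r) - max 0 (1 - dist y p / r)) • (q - p) := by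
      simp only [f, ContinuousLinearEquiv.coe_coe, ContinuousLinearEquiv.refl_apply, sub_smul]
      abel
    rw [e1, norm_smul]
    have e2 : ‖max 0 (1 - dist x p / r) - max 0 (1 - dist y p / r)‖ ≤ ‖x - y‖ / r := by
      rw [Real.norm_eq_abs]
      refine (abs_max_sub_max_le_max _ _ _ _).trans ?_
      rw [sub_self, abs_zero, max_eq_right (abs_nonneg _)]
      rw [show (1 - dist x p / r) - (1 - dist y p / r) = (dist y p - dist x p) / r by ring, abs_div, abs_of_pos hr]
      gcongr
      rw [← dist_eq_norm, dist_comm x y]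
      exact abs_dist_sub_le y x p
    have e3 : ‖q - p‖ = dist q p := (dist_eq_norm _ _).symm
    rw [e3]
    calc _ ≤ ‖x - y‖ / r * dist q p := by gcongr
      _ = (dist q p / r) * ‖x - y‖ := by ring
      _ = _ := rfl
  have hc : c < ‖((ContinuousLinearEquiv.refl ℝ (ℝ × ℝ) : (ℝ × ℝ) ≃L[ℝ] (ℝ × ℝ)).symm : (ℝ × ℝ) →L[ℝ] (ℝ × ℝ))‖₊⁻¹ := by
    have : ‖((ContinuousLinearEquiv.refl ℝ (ℝ × ℝ) : (ℝ × ℝ) ≃L[ℝ] (ℝ × ℝ)).symm : (ℝ × ℝ) →L[ℝ] (ℝ × ℝ))‖₊ = 1 := by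
      have h1 : ((ContinuousLinearEquiv.refl ℝ (ℝ × ℝ) : (ℝ × ℝ) ≃L[ℝ] (ℝ × ℝ)).symm : (ℝ × ℝ) →L[ℝ] (ℝ × ℝ)) = ContinuousLinearMap.id ℝ _ := rfl
      rw [h1]
      exact NNReal.eq (ContinuousLinearMap.norm_id)
    rw [this, inv_one]
    show dist q p / r < 1
    rw [div_lt_one hr]; exact h
  refine ⟨hf.toHomeomorph f (Or.inr hc), ?_, ?_⟩
  · show f p = q
    simp [f]
  · intro x hx
    show f x = x
    have : 1 - dist x p / r ≤ 0 := by
      rw [mem_ball, not_lt] at hx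
      rw [sub_nonpos, one_le_div hr]; exact hx
    simp [f, max_eq_left this]

lemma exists_homeo_of_connected (O T : Set (ℝ × ℝ)) (hO : IsOpen O) (hT : IsPreconnected T)
    (hTO : T ⊆ O) (p q : ℝ × ℝ) (hp : p ∈ T) (hq : q ∈ T) :
    ∃ e : (ℝ × ℝ) ≃ₜ (ℝ × ℝ), e p = q ∧ ∀ x, x ∉ O → e x = x := by
  let R : ℝ × ℝ → Prop := fun q => ∃ e : (ℝ × ℝ) ≃ₜ (ℝ × ℝ), e p = q ∧ ∀ x, x ∉ O → e x = x
  have step : ∀ x ∈ O, ∃ r > 0, ∀ y ∈ ball x r, y ∈ O ∧ (R x ↔ R y) := by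
    intro x hx
    obtain ⟨r, hr, hb⟩ := Metric.isOpen_iff.1 hO x hx
    refine ⟨r, hr, fun y hy => ⟨hb hy, ?_⟩⟩
    obtain ⟨e, he, hf⟩ := exists_homeo_ball x y r hy
    constructor
    · rintro ⟨g, hg, hg'⟩
      refine ⟨g.trans e, by simp [hg, he], fun z hz => ?_⟩
      simp [hg' z hz, hf z (fun h => hz (hb h))]
    · rintro ⟨g, hg, hg'⟩
      refine ⟨g.trans e.symm, by simp [hg, ← he], fun z hz => ?_⟩
      have : e z = z := hf z (fun h => hz (hb h))
      simp only [Homeomorph.trans_apply, hg' z hz]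
      rw [Homeomorph.symm_apply_eq, this]
  have hu : IsOpen {x | x ∈ O ∧ R x} := by
    rw [Metric.isOpen_iff]
    rintro x ⟨hx, hR⟩
    obtain ⟨r, hr, h⟩ := step x hx
    exact ⟨r, hr, fun y hy => ⟨(h y hy).1, (h y hy).2.1 hR⟩⟩
  have hv : IsOpen {x | x ∈ O ∧ ¬ R x} := by
    rw [Metric.isOpen_iff]
    rintro x ⟨hx, hR⟩
    obtain ⟨r, hr, h⟩ := step x hx
    exact ⟨r, hr, fun y hy => ⟨(h y hy).1, fun h' => hR ((h y hy).2.2 h')⟩⟩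
  have := hT.subset_left_of_subset_union hu hv
    (Set.disjoint_left.2 fun x h1 h2 => h2.2 h1.2)
    (fun x hx => by
      by_cases h : R x
      · exact Or.inl ⟨hTO hx, h⟩
      · exact Or.inr ⟨hTO hx, h⟩)
    ⟨p, hp, hTO hp, Homeomorph.refl _, rfl, fun _ _ => rfl⟩
  exact (this hq).2

lemma boundary_bumping {X : Type*} [TopologicalSpace X] [T2Space X] (C U : Set X)
    (hC : IsCompact C) (hC' : IsPreconnected C) (hU : IsClosed U) (u w : X) (hu : u ∈ C ∩ U)
    (hw : w ∈ C \ U) :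
    ∃ v ∈ connectedComponentIn (C ∩ U) u, v ∈ closure (C \ U) := by
  by_contra! hcon
  have hE : IsCompact (C ∩ U) := hC.inter_right hU
  have : CompactSpace ↥(C ∩ U) := isCompact_iff_compactSpace.1 hE
  set B := closure (C \ U) with hB
  let u' : ↥(C ∩ U) := ⟨u, hu⟩
  have hcc : connectedComponentIn (C ∩ U) u = Subtype.val '' (connectedComponent u') :=
    connectedComponentIn_eq_image hu
  have : Nonempty { s : Set ↥(C ∩ U) // IsClopen s ∧ u' ∈ s } :=
    ⟨⟨univ, isClopen_univ, mem_univ _⟩⟩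
  obtain ⟨H, hH⟩ := exists_subset_nhds_of_compactSpace
    (V := fun s : { s : Set ↥(C ∩ U) // IsClopen s ∧ u' ∈ s } => s.1)
    (by
      intro a b
      exact ⟨⟨a.1 ∩ b.1, a.2.1.inter b.2.1, a.2.2, b.2.2⟩, inter_subset_left, inter_subset_right⟩)
    (fun i => i.2.1.isClosed) (U := (Subtype.val ⁻¹' B)ᶜ) (by
      intro x hx
      rw [← connectedComponent_eq_iInter_isClopen] at hx
      apply IsOpen.mem_nhds
      · exact ((isClosed_closure).preimage continuous_subtype_val).isOpen_compl
      · intro hxB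
        exact hcon x (hcc ▸ mem_image_of_mem _ hx) hxB)
  have hemb := hE.isClosed.isClosedEmbedding_subtypeVal
  have h1 : IsClosed (Subtype.val '' H.1) := hemb.isClosedMap _ H.2.1.isClosed
  have h2 : IsClosed (Subtype.val '' H.1ᶜ ∪ B) :=
    (hemb.isClosedMap _ H.2.1.compl.isClosed).union isClosed_closure
  have := isPreconnected_closed_iff.1 hC' _ _ h1 h2 (by
    intro x hx
    by_cases hxU : x ∈ U
    · by_cases hxH : (⟨x, hx, hxU⟩ : ↥(C ∩ U)) ∈ H.1
      · exact Or.inl ⟨_, hxH, rfl⟩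
      · exact Or.inr (Or.inl ⟨_, hxH, rfl⟩)
    · exact Or.inr (Or.inr (subset_closure ⟨hx, hxU⟩)))
    ⟨u, hu.1, u', H.2.2, rfl⟩ ⟨w, hw.1, Or.inr (subset_closure hw)⟩
  obtain ⟨x, -, ⟨x', hx', rfl⟩, h | h⟩ := this
  · obtain ⟨y, hy, hyx⟩ := h
    rw [Subtype.val_inj] at hyx
    exact hy (hyx ▸ hx')
  · exact hH hx' h

open TopologicalSpace in
lemma limit_connected {S : Type*} [MetricSpace S] (P : ℕ → NonemptyCompacts S)
    (L : NonemptyCompacts S) (hP : ∀ n, IsConnected (P n : Set S))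
    (hL : Tendsto P atTop (𝓝 L)) : IsConnected (L : Set S) := by
  refine ⟨L.nonempty, ?_⟩
  rw [isPreconnected_iff_subset_of_fully_disjoint_closed L.isCompact.isClosed]
  intro u v hu hv hLuv hd
  obtain ⟨U, V, hU, hV, huU, hvV, hUV⟩ := normal_separation hu hv hd
  by_contra! hcon
  obtain ⟨⟨a, ha, hau⟩, ⟨b, hb, hbv⟩⟩ : (∃ a ∈ (L : Set S), a ∉ u) ∧ ∃ b ∈ (L : Set S), b ∉ v := by
    simpa [Set.not_subset] using hcon
  have haV : a ∈ V := hvV ((hLuv ha).resolve_left hau)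
  have hbU : b ∈ U := huU ((hLuv hb).resolve_right hbv)
  have e1 : ∀ᶠ n in atTop, (P n : Set S) ⊆ U ∪ V := by
    exact hL <| (NonemptyCompacts.isOpen_subsets_of_isOpen (hU.union hV)).mem_nhds
      (hLuv.trans (union_subset_union huU hvV))
  have e2 : ∀ᶠ n in atTop, ((P n : Set S) ∩ U).Nonempty := by
    exact hL <| (NonemptyCompacts.isOpen_inter_nonempty_of_isOpen hU).mem_nhds ⟨b, hb, hbU⟩
  have e3 : ∀ᶠ n in atTop, ((P n : Set S) ∩ V).Nonempty := by
    exact hL <| (NonemptyCompacts.isOpen_inter_nonempty_of_isOpen hV).mem_nhds ⟨a, ha, haV⟩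
  obtain ⟨n, h1, ⟨y, hy, hyU⟩, ⟨w, hw, hwV⟩⟩ := (e1.and (e2.and e3)).exists
  rcases (hP n).isPreconnected.subset_or_subset hU hV hUV h1 with h | h
  · exact Set.disjoint_left.1 hUV (h hw) hwV
  · exact Set.disjoint_left.1 hUV hyU (h hy)


/-- The closed unit square in the plane. -/
def planeSq : Set (ℝ × ℝ) := Icc 0 1 ×ˢ Icc 0 1

/-- The coordinatewise retraction of the plane onto the unit square. -/
def retSq (p : ℝ × ℝ) : ℝ × ℝ := (max 0 (min 1 p.1), max 0 (min 1 p.2))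

lemma continuous_retSq : Continuous retSq := by
  unfold retSq; fun_prop

lemma retSq_mem (p : ℝ × ℝ) : retSq p ∈ planeSq :=
  ⟨⟨le_max_left _ _, max_le zero_le_one (min_le_left _ _)⟩,
    ⟨le_max_left _ _, max_le zero_le_one (min_le_left _ _)⟩⟩

lemma retSq_eq {p : ℝ × ℝ} (hp : p ∈ planeSq) : retSq p = p := by
  obtain ⟨⟨h1, h2⟩, h3, h4⟩ := hp
  ext <;> simp [retSq, *]

lemma exists_path_sq (A Z : Set (ℝ × ℝ)) (hA : IsPreconnected A) (hAS : A ⊆ planeSq)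
    (hZ : IsClosed Z) (hAZ : Disjoint A Z) (a b : ℝ × ℝ) (ha : a ∈ A) (hb : b ∈ A) :
    ∃ γ : Path a b, ∀ t, γ t ∈ planeSq ∧ γ t ∉ Z := by
  set W : Set (ℝ × ℝ) := {p | retSq p ∉ Z} with hW
  have hWo : IsOpen W := hZ.isOpen_compl.preimage continuous_retSq
  have hAW : A ⊆ W := by
    intro p hp
    show retSq p ∉ Z
    rw [retSq_eq (hAS hp)]
    exact Set.disjoint_left.1 hAZ hp
  have hV : IsConnected (connectedComponentIn W a) :=
    isConnected_connectedComponentIn_iff.2 (hAW ha)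
  have hV' := (hWo.connectedComponentIn (x := a)).isConnected_iff_isPathConnected.1 hV
  have hbV : b ∈ connectedComponentIn W a := hA.subset_connectedComponentIn ha hAW hb
  obtain ⟨γ, hγ⟩ := hV'.joinedIn a (mem_connectedComponentIn (hAW ha)) b hbV
  refine ⟨(γ.map continuous_retSq).cast (retSq_eq (hAS ha)).symm (retSq_eq (hAS hb)).symm, ?_⟩
  intro t
  exact ⟨retSq_mem _, connectedComponentIn_subset _ _ (hγ t)⟩

lemma no_crossing (A E : Set (ℝ × ℝ)) (hA : IsPreconnected A) (hAS : A ⊆ planeSq)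
    (hE : IsPreconnected E) (hE' : IsClosed E) (hES : E ⊆ planeSq) (hAE : Disjoint A E)
    (a0 a1 e0 e1 : ℝ × ℝ) (ha0 : a0 ∈ A) (ha1 : a1 ∈ A) (he0 : e0 ∈ E) (he1 : e1 ∈ E)
    (h0 : a0.1 = 0) (h1 : a1.1 = 1) (h2 : e0.2 = 0) (h3 : e1.2 = 1) : False := by
  obtain ⟨γ, hγ⟩ := exists_path_sq A E hA hAS hE' hAE a0 a1 ha0 ha1
  obtain ⟨η, hη⟩ := exists_path_sq E (range γ) hE hES (isCompact_range γ.continuous).isClosed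
    (by
      rw [Set.disjoint_left]
      rintro _ hx ⟨t, rfl⟩
      exact (hγ t).2 hx) e0 e1 he0 he1
  have hγe : ∀ s, ∃ t, γ.extend s = γ t := fun s => ⟨projIcc 0 1 zero_le_one s, rfl⟩
  have hηe : ∀ s, ∃ t, η.extend s = η t := fun s => ⟨projIcc 0 1 zero_le_one s, rfl⟩
  have hγS : ∀ s, γ.extend s ∈ planeSq := fun s => by
    obtain ⟨t, ht⟩ := hγe s; rw [ht]; exact (hγ t).1
  have hηS : ∀ s, η.extend s ∈ planeSq := fun s => by
    obtain ⟨t, ht⟩ := hηe s; rw [ht]; exact (hη t).1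
  refine crossing γ.extend η.extend γ.continuous_extend η.continuous_extend ?_ ?_ ?_ ?_ ?_
  · intro s t h
    obtain ⟨s', hs⟩ := hγe s
    obtain ⟨t', ht⟩ := hηe t
    exact (hη t').2 ⟨s', by rw [← hs, ← ht, h]⟩
  · intro t; rw [γ.extend_zero, h0]; exact (hηS t).1.1
  · intro t; rw [γ.extend_one, h1]; exact (hηS t).1.2
  · intro t; rw [η.extend_zero, h2]; exact (hγS t).2.1
  · intro t; rw [η.extend_one, h3]; exact (hγS t).2.2

/-- From a point `l` off a compact set `E`, one reaches `E` inside the square through a connected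
set `ret V` of points off `E`. -/
lemma exists_reach (E : Set (ℝ × ℝ)) (hE' : IsClosed E) (hES : E ⊆ planeSq)
    (w : ℝ × ℝ) (hw : w ∈ E) (l : ℝ × ℝ) (hl : l ∈ planeSq) (hlE : l ∉ E) :
    ∃ V : Set (ℝ × ℝ), IsPreconnected V ∧ V ⊆ planeSq ∧ Disjoint V E ∧ l ∈ V ∧
      ∃ p ∈ E, IsPreconnected (V ∪ {p}) := by
  set W : Set (ℝ × ℝ) := {p | retSq p ∉ E} with hW
  have hWo : IsOpen W := hE'.isOpen_compl.preimage continuous_retSq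
  have hlW : l ∈ W := by
    show retSq l ∉ E
    rwa [retSq_eq hl]
  set V := connectedComponentIn W l with hV
  have hVo : IsOpen V := hWo.connectedComponentIn
  have hlV : l ∈ V := mem_connectedComponentIn hlW
  have hVp : IsPreconnected V := isPreconnected_connectedComponentIn
  have hex : ∃ p ∈ closure V, p ∉ V := by
    by_contra! hcon
    have hcl : IsClopen V := ⟨isClosed_of_closure_subset hcon, hVo⟩
    have := hcl.eq_univ ⟨l, hlV⟩
    have hwV : w ∈ V := by rw [this]; trivial
    have : retSq w ∉ E := connectedComponentIn_subset _ _ hwV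
    rw [retSq_eq (hES hw)] at this
    exact this hw
  obtain ⟨p, hp, hpV⟩ := hex
  have hVp' : IsPreconnected (V ∪ {p}) := hVp.subset_closure subset_union_left
    (union_subset subset_closure (by simpa using hp))
  have hpE : retSq p ∈ E := by
    by_contra hcon
    exact hpV (hVp'.subset_connectedComponentIn (Or.inl hlV)
      (union_subset (connectedComponentIn_subset _ _) (by rintro _ rfl; exact hcon)) (Or.inr rfl))
  refine ⟨retSq '' V, hVp.image _ continuous_retSq.continuousOn, ?_, ?_, ⟨l, hlV, retSq_eq hl⟩,
    retSq p, hpE, ?_⟩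
  · rintro _ ⟨q, -, rfl⟩; exact retSq_mem q
  · rw [Set.disjoint_left]
    rintro _ ⟨q, hq, rfl⟩
    exact connectedComponentIn_subset _ _ hq
  · have := hVp'.image _ continuous_retSq.continuousOn
    rwa [image_union, image_singleton] at this

lemma exists_access (E Z : Set (ℝ × ℝ)) (hE : IsPreconnected E) (hE' : IsClosed E)
    (hES : E ⊆ planeSq) (hZ : IsPreconnected Z) (hZ' : IsClosed Z) (hZS : Z ⊆ planeSq)
    (hEZ : Disjoint E Z) (e0 e1 : ℝ × ℝ) (he0 : e0 ∈ E) (he1 : e1 ∈ E)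
    (h2 : e0.2 = 0) (h3 : e1.2 = 1) (l r : ℝ × ℝ) (hl : l ∈ planeSq) (hr : r ∈ planeSq)
    (hl0 : l.1 = 0) (hr1 : r.1 = 1) (hlE : l ∉ E) (hrE : r ∉ E)
    (w : ℝ × ℝ) (hw : w ∈ E) :
    (∃ γ : Path l w, ∀ t, γ t ∈ planeSq ∧ γ t ∉ Z) ∨
    (∃ γ : Path r w, ∀ t, γ t ∈ planeSq ∧ γ t ∉ Z) := by
  obtain ⟨V, hV, hVS, hVE, hlV, p, hp, hVp⟩ := exists_reach E hE' hES w hw l hl hlE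
  obtain ⟨V', hV', hVS', hVE', hlV', p', hp', hVp'⟩ := exists_reach E hE' hES w hw r hr hrE
  by_cases hd : Disjoint V Z
  · left
    have : IsPreconnected ((V ∪ {p}) ∪ E) := hVp.union p (Or.inr rfl) hp hE
    refine exists_path_sq _ Z this ?_ hZ' ?_ l w (Or.inl (Or.inl hlV)) (Or.inr hw)
    · exact union_subset (union_subset hVS (by simpa using hES hp)) hES
    · rw [Set.disjoint_union_left, Set.disjoint_union_left]
      exact ⟨⟨hd, by simpa using Set.disjoint_left.1 hEZ hp⟩, hEZ⟩
  by_cases hd' : Disjoint V' Z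
  · right
    have : IsPreconnected ((V' ∪ {p'}) ∪ E) := hVp'.union p' (Or.inr rfl) hp' hE
    refine exists_path_sq _ Z this ?_ hZ' ?_ r w (Or.inl (Or.inl hlV')) (Or.inr hw)
    · exact union_subset (union_subset hVS' (by simpa using hES hp')) hES
    · rw [Set.disjoint_union_left, Set.disjoint_union_left]
      exact ⟨⟨hd', by simpa using Set.disjoint_left.1 hEZ hp'⟩, hEZ⟩
  exfalso
  obtain ⟨a, ha, haZ⟩ := Set.not_disjoint_iff.1 hd
  obtain ⟨b, hb, hbZ⟩ := Set.not_disjoint_iff.1 hd'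
  have h5 : IsPreconnected ((V ∪ Z) ∪ V') :=
    (hV.union a ha haZ hZ).union b (Or.inr hbZ) hb hV'
  refine no_crossing _ E h5 ?_ hE hE' hES ?_ l r e0 e1 (Or.inl (Or.inl hlV)) (Or.inr hlV')
    he0 he1 hl0 hr1 h2 h3
  · exact union_subset (union_subset hVS hZS) hVS'
  · rw [Set.disjoint_union_left, Set.disjoint_union_left]
    exact ⟨⟨hVE, hEZ.symm⟩, hVE'⟩


/-! ### Hausdorff limits -/

lemma haus_near {S : Type*} [MetricSpace S] [CompactSpace S] {A : ℕ → Set S} {L : Set S}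
    (hA : ∀ n, (A n).Nonempty) (hL : L.Nonempty)
    (hlim : Tendsto (fun n => hausdorffDist (A n) L) atTop (𝓝 0)) {η : ℝ} (hη : 0 < η) :
    ∀ᶠ n in atTop, (∀ q ∈ A n, ∃ z ∈ L, dist q z < η) ∧ (∀ z ∈ L, ∃ q ∈ A n, dist q z < η) := by
  filter_upwards [hlim.eventually (gt_mem_nhds hη)] with n hn
  have hfin : hausdorffEDist (A n) L ≠ ⊤ :=
    hausdorffEDist_ne_top_of_nonempty_of_bounded (hA n) hL (isBounded_of_compactSpace)
      (isBounded_of_compactSpace)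
  exact ⟨fun q hq => exists_dist_lt_of_hausdorffDist_lt hq hn hfin,
    fun z hz => exists_dist_lt_of_hausdorffDist_lt' hz hn hfin⟩

lemma haus_mem {S : Type*} [MetricSpace S] [CompactSpace S] {A : ℕ → Set S} {L : Set S}
    (hA : ∀ n, (A n).Nonempty) (hL : L.Nonempty) (hLc : IsClosed L)
    (hlim : Tendsto (fun n => hausdorffDist (A n) L) atTop (𝓝 0)) {a : ℕ → S} {x : S}
    (ha : ∀ n, a n ∈ A n) (hx : Tendsto a atTop (𝓝 x)) : x ∈ L := by
  rw [← hLc.closure_eq, Metric.mem_closure_iff]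
  intro ε hε
  obtain ⟨n, ⟨h1, -⟩, h2⟩ := ((haus_near hA hL hlim (half_pos hε)).and
    (Metric.tendsto_nhds.1 hx (ε/2) (half_pos hε))).exists
  obtain ⟨z, hz, hd⟩ := h1 _ (ha n)
  refine ⟨z, hz, ?_⟩
  have := dist_triangle x (a n) z
  rw [dist_comm x (a n)] at this
  linarith

/-! ### Pushing a point along a path -/

lemma exists_push (F : ℝ × ℝ → ℝ) (hF : Continuous F) (ζ w : ℝ × ℝ) (ε : ℝ)
    (hball : ball ζ ε ⊆ Ioo 0 1 ×ˢ Ioo 0 1) (hw : w ∈ ball ζ ε)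
    (γ : Path ((0 : ℝ), (3/4 : ℝ)) w) (hγ : ∀ t, γ t ∈ planeSq ∧ 0 < F (γ t))
    (ρ : ℝ) (hρ : 0 < ρ) :
    ∃ a : ℝ, 0 < a ∧ a < ρ ∧ ∃ η : ℝ, 0 < η ∧ ∃ h : (ℝ × ℝ) ≃ₜ (ℝ × ℝ), h (a, 3/4) = ζ ∧
      ∀ p, h p ≠ p → p ∈ Ioo (0:ℝ) 1 ×ˢ Ioo (0:ℝ) 1 ∧ (dist p ζ < ε ∨ η < F p) := by
  obtain ⟨t0, -, ht0⟩ := isCompact_univ.exists_isMinOn (univ_nonempty (α := unitInterval))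
    (hF.comp γ.continuous).continuousOn
  have hη0 := (hγ t0).2
  set η := F (γ t0) / 2 with hη
  let c : ℝ → ℝ × ℝ → ℝ × ℝ := fun m p => ((1 - m) * p.1 + m * (1/2), (1 - m) * p.2 + m * (3/4))
  have hc : Continuous (fun x : ℝ × (ℝ × ℝ) => c x.1 x.2) := by
    simp only [c]; fun_prop
  have hc0 : ∀ p, c 0 p = p := by intro p; simp [c]
  have e1 : ∀ᶠ m in 𝓝 (0:ℝ), ∀ t ∈ (univ : Set unitInterval), η < F (c m (γ t)) := by
    apply isCompact_univ.eventually_forall_of_forall_eventually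
    intro t _
    have hcont : Continuous (fun z : ℝ × unitInterval => F (c z.1 (γ z.2))) :=
      hF.comp (hc.comp (continuous_fst.prodMk (γ.continuous.comp continuous_snd)))
    have := (hcont.tendsto (0, t)).eventually (lt_mem_nhds (a := η) ?_)
    · exact this
    · simp only [hc0]
      have := ht0 (mem_univ t)
      simp only [Set.mem_ofPred_eq, Function.comp] at this
      linarith
  have e2 : ∀ᶠ m in 𝓝 (0:ℝ), c m w ∈ ball ζ ε := by
    have hcont : Continuous (fun m : ℝ => c m w) := hc.comp (continuous_id.prodMk continuous_const)
    apply (hcont.tendsto 0).eventually (isOpen_ball.mem_nhds _)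
    rw [hc0]; exact hw
  have e3 : ∀ᶠ m in 𝓝 (0:ℝ), m < min 1 ρ := gt_mem_nhds (lt_min one_pos hρ)
  obtain ⟨m, ⟨⟨h1, h2⟩, h3⟩, hm0⟩ := ((((e1.and e2).and e3).filter_mono
    (nhdsWithin_le_nhds (s := Ioi 0))).and self_mem_nhdsWithin).exists
  have hm0 : 0 < m := hm0
  have hm1 : m < 1 := h3.trans_le (min_le_left _ _)
  have hm2 : m < ρ := h3.trans_le (min_le_right _ _)
  set O : Set (ℝ × ℝ) := (Ioo (0:ℝ) 1 ×ˢ Ioo (0:ℝ) 1) ∩ (ball ζ ε ∪ {p | η < F p}) with hO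
  have hOo : IsOpen O := (isOpen_Ioo.prod isOpen_Ioo).inter
    (isOpen_ball.union (isOpen_lt continuous_const hF))
  have hcm : Continuous (c m) := hc.comp (continuous_const.prodMk continuous_id)
  have hT : IsPreconnected (range (fun t => c m (γ t)) ∪ ball ζ ε) :=
    (isPreconnected_range (hcm.comp γ.continuous)).union (c m w) ⟨1, by simp⟩ h2
      (convex_ball ζ ε).isPreconnected
  have hTO : range (fun t => c m (γ t)) ∪ ball ζ ε ⊆ O := by
    apply union_subset
    · rintro _ ⟨t, rfl⟩
      obtain ⟨⟨q1, q2⟩, q3, q4⟩ := (hγ t).1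
      refine ⟨⟨⟨?_, ?_⟩, ?_, ?_⟩, Or.inr (h1 t (mem_univ t))⟩ <;> simp only [c] <;> nlinarith
    · intro p hp
      exact ⟨hball hp, Or.inl hp⟩
  have hε : 0 < ε := dist_nonneg.trans_lt hw
  obtain ⟨e, he, he'⟩ := exists_homeo_of_connected O _ hOo hT hTO (c m (0, 3/4)) ζ
    (Or.inl ⟨0, by simp⟩) (Or.inr (mem_ball_self hε))
  refine ⟨m/2, by linarith, by linarith, η, by rw [hη]; linarith, e, ?_, ?_⟩
  · rw [← he]; congr 1; ext <;> simp only [c] <;> ring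
  · intro p hp
    have : p ∈ O := by
      by_contra hcon
      exact hp (he' p hcon)
    exact ⟨this.1, this.2⟩

/-! ### The notched square -/

lemma exists_notch (δ : ℝ) (h0 : 0 < δ) (h1 : δ ≤ 1/8) :
    ∃ Ψ : unitInterval × unitInterval → ℝ × ℝ, Continuous Ψ ∧ Function.Injective Ψ ∧
      (∀ q, Ψ q ∈ planeSq ∧ δ - |(Ψ q).2 - 3/4| ≤ (Ψ q).1) ∧
      (∀ p ∈ planeSq, δ - |p.2 - 3/4| ≤ p.1 → p ∈ range Ψ) ∧
      (∀ s : unitInterval, Ψ (s, 0) = ((s:ℝ), 0)) ∧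
      (∀ t : unitInterval, Ψ (0, t) = (0, (t:ℝ)/2)) ∧
      (∀ t : unitInterval, Ψ (1, t) = (1, (t:ℝ))) ∧
      (∀ p ∈ planeSq, δ - |p.2 - 3/4| = p.1 → p ∈ Ψ '' {q | q.2 = 1}) := by
  let β : ℝ → ℝ := fun τ => max 0 (δ - |τ - 3/4|)
  let b : ℝ → ℝ := fun τ => max 0 (min (1/2) (τ - 1/2))
  let g : ℝ → ℝ := fun s => max (1/2) (min 1 (1/2 + s))
  let κ : ℝ → ℝ := fun τ => (1 - β τ) / (1 - b τ)
  have hβ0 : ∀ τ, 0 ≤ β τ := fun τ => le_max_left _ _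
  have hβ1 : ∀ τ, β τ ≤ 1/8 := fun τ => max_le (by norm_num) (by linarith [abs_nonneg (τ - 3/4)])
  have hβ2 : ∀ τ, τ ≤ 1/2 → β τ = 0 := fun τ hτ => max_eq_left (by
    rw [abs_of_neg (by linarith)]; linarith)
  have hb0 : ∀ τ, 0 ≤ b τ := fun τ => le_max_left _ _
  have hb1 : ∀ τ, b τ ≤ 1/2 := fun τ => max_le (by norm_num) (min_le_left _ _)
  have hb2 : ∀ τ, τ ≤ 1/2 → b τ = 0 := fun τ hτ => max_eq_left
    ((min_le_right _ _).trans (by linarith))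
  have hb3 : ∀ τ, 1/2 ≤ τ → τ ≤ 1 → b τ = τ - 1/2 := fun τ hτ hτ' => by
    simp only [b]; rw [min_eq_right (by linarith), max_eq_right (by linarith)]
  have hg0 : ∀ s, 1/2 ≤ g s := fun s => le_max_left _ _
  have hg1 : ∀ s, g s ≤ 1 := fun s => max_le (by norm_num) (min_le_left _ _)
  have hg2 : ∀ s, 0 ≤ s → g s ≤ 1/2 + s := fun s hs => max_le (by linarith) (min_le_right _ _)
  have hg3 : ∀ s, 0 ≤ s → s ≤ 1/2 → g s = 1/2 + s := fun s hs hs' => by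
    simp only [g]; rw [min_eq_right (by linarith), max_eq_right (by linarith)]
  have hg4 : ∀ s, 1/2 ≤ s → g s = 1 := fun s hs => by
    simp only [g]; rw [min_eq_left (by linarith), max_eq_right (by norm_num)]
  have hκ : ∀ τ, 0 < κ τ := fun τ => div_pos (by linarith [hβ1 τ]) (by linarith [hb1 τ])
  have hκm : ∀ τ, κ τ * (1 - b τ) = 1 - β τ := fun τ =>
    div_mul_cancel₀ _ (by linarith [hb1 τ])
  have hκ1 : ∀ τ, τ ≤ 1/2 → κ τ = 1 := fun τ hτ => by
    simp only [κ]; rw [hβ2 τ hτ, hb2 τ hτ]; norm_num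
  have hκc : Continuous κ := by
    apply Continuous.div
    · simp only [β]; fun_prop
    · simp only [b]; fun_prop
    · intro τ; linarith [hb1 τ]
  have hgc : Continuous g := by simp only [g]; fun_prop
  let Ψ : unitInterval × unitInterval → ℝ × ℝ := fun q =>
    (1 - (1 - (q.1:ℝ)) * κ (q.2 * g q.1), q.2 * g q.1)
  have hinv : ∀ p ∈ planeSq, δ - |p.2 - 3/4| ≤ p.1 → ∃ q : unitInterval × unitInterval,
      Ψ q = p ∧ (1 - (q.1 : ℝ)) * κ p.2 = 1 - p.1 ∧ (q.2 : ℝ) = p.2 / g q.1 := by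
    rintro ⟨a, τ⟩ ⟨⟨ha0, ha1⟩, hτ0, hτ1⟩ hp
    simp only at ha0 ha1 hτ0 hτ1 hp
    have hβa : β τ ≤ a := max_le ha0 hp
    set s := 1 - (1 - a) / κ τ with hs
    have hsκ : (1 - s) * κ τ = 1 - a := by
      rw [hs]; have := (hκ τ).ne'; field_simp; ring
    have hsb : b τ ≤ s := by
      have : (1 - s) * κ τ ≤ (1 - b τ) * κ τ := by
        rw [hsκ, mul_comm, hκm]; linarith
      have := le_of_mul_le_mul_right this (hκ τ)
      linarith
    have hs1 : s ≤ 1 := by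
      have : 0 ≤ (1 - a) / κ τ := div_nonneg (by linarith) (hκ τ).le
      linarith
    have hs0 : 0 ≤ s := (hb0 τ).trans hsb
    have hgτ : τ ≤ g s := by
      by_cases hτ : τ ≤ 1/2
      · exact hτ.trans (hg0 s)
      · push Not at hτ
        rw [hb3 τ hτ.le hτ1] at hsb
        by_cases hs2 : s ≤ 1/2
        · rw [hg3 s hs0 hs2]; linarith
        · rw [hg4 s (by linarith)]; exact hτ1
    have hgp : 0 < g s := by linarith [hg0 s]
    have ht1 : τ / g s ≤ 1 := (div_le_one hgp).2 hgτ
    refine ⟨(⟨s, hs0, hs1⟩, ⟨τ / g s, by positivity, ht1⟩), ?_, ?_, rfl⟩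
    · simp only [Ψ]
      rw [div_mul_cancel₀ _ hgp.ne', hsκ]
      simp
    · exact hsκ
  refine ⟨Ψ, ?_, ?_, ?_, ?_, ?_, ?_, ?_, ?_⟩
  · simp only [Ψ]
    have := hκc.comp (g := κ) (f := fun q : unitInterval × unitInterval => (q.2:ℝ) * g q.1)
      (by fun_prop)
    simp only [Function.comp_def] at this
    fun_prop
  · rintro ⟨s, t⟩ ⟨s', t'⟩ h
    simp only [Ψ, Prod.mk.injEq] at h
    obtain ⟨e1, e2⟩ := h
    rw [e2] at e1
    have h3 : (1 - (s:ℝ)) * κ (t' * g s') = (1 - (s':ℝ)) * κ (t' * g s') := by linarith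
    have h4 := mul_right_cancel₀ (hκ _).ne' h3
    have h5 : s = s' := Subtype.ext (by linarith)
    subst h5
    have h6 := mul_right_cancel₀ (by linarith [hg0 s] : g s ≠ 0) e2
    rw [Prod.mk.injEq]
    exact ⟨rfl, Subtype.ext h6⟩
  · rintro ⟨s, t⟩
    obtain ⟨s, hs0, hs1⟩ := s
    obtain ⟨t, ht0, ht1⟩ := t
    simp only [Ψ]
    set τ := t * g s with hτ
    have hg := hg0 s
    have hτ0 : 0 ≤ τ := mul_nonneg ht0 (by linarith)
    have hτg : τ ≤ g s := mul_le_of_le_one_left (by linarith) ht1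
    have hbs : b τ ≤ s := max_le hs0 ((min_le_right _ _).trans (by linarith [hg2 s hs0]))
    have hk : (1 - s) * κ τ ≤ 1 - β τ := by
      rw [← hκm τ, mul_comm]
      exact mul_le_mul_of_nonneg_left (by linarith) (hκ τ).le
    have hk0 : 0 ≤ (1 - s) * κ τ := mul_nonneg (by linarith) (hκ τ).le
    have hβ' : δ - |τ - 3/4| ≤ β τ := le_max_right _ _
    refine ⟨⟨⟨?_, ?_⟩, ?_, ?_⟩, ?_⟩ <;> (try simp only) <;> linarith [hβ0 τ, hg1 s]
  · intro p hp hp'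
    obtain ⟨q, hq, -⟩ := hinv p hp hp'
    exact ⟨q, hq⟩
  · intro s
    simp only [Ψ, Icc.coe_zero, zero_mul]
    rw [hκ1 0 (by norm_num)]
    simp
  · intro t
    simp only [Ψ, Icc.coe_zero]
    rw [hg3 0 le_rfl (by norm_num), hκ1 _ (by linarith [t.2.2])]
    ext <;> simp; ring
  · intro t
    simp only [Ψ, Icc.coe_one]
    rw [hg4 1 (by norm_num)]
    simp
  · intro p hp hp'
    obtain ⟨q, hq, hq1, hq2⟩ := hinv p hp hp'.le
    refine ⟨q, ?_, hq⟩
    have hτ := abs_le.1 (show |p.2 - 3/4| ≤ 1/8 by linarith [hp.1.1])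
    have hβ' : β p.2 = p.1 := by simp only [β]; rw [hp', max_eq_right hp.1.1]
    have h3 := hκm p.2
    rw [hβ', ← hq1, mul_comm] at h3
    have h4 := mul_right_cancel₀ (hκ _).ne' h3
    rw [hb3 _ (by linarith) hp.2.2] at h4
    have h5 : (q.1:ℝ) = p.2 - 1/2 := by linarith
    have h6 : g q.1 = p.2 := by
      rw [h5, hg3 _ (by linarith) (by linarith)]; ring
    apply Subtype.ext
    rw [hq2, h6, div_self (by linarith)]
    rfl

/-! ### The square in the plane and in the unit interval squared -/

lemma isClosed_connComp {X : Type*} [TopologicalSpace X] {F : Set X} (hF : IsClosed F) (x : X) :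
    IsClosed (connectedComponentIn F x) := by
  by_cases hx : x ∈ F
  · apply isClosed_of_closure_subset
    exact isPreconnected_connectedComponentIn.closure.subset_connectedComponentIn
      (subset_closure (mem_connectedComponentIn hx))
      (closure_minimal (connectedComponentIn_subset _ _) hF)
  · rw [connectedComponentIn_eq_empty hx]; exact isClosed_empty

/-- The projection of the plane onto the unit square. -/
noncomputable def projSq (p : ℝ × ℝ) : unitInterval × unitInterval :=
  (projIcc 0 1 zero_le_one p.1, projIcc 0 1 zero_le_one p.2)

lemma continuous_projSq : Continuous projSq := by
  unfold projSq
  exact (continuous_projIcc.comp continuous_fst).prodMk (continuous_projIcc.comp continuous_snd)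

lemma projSq_of {p : ℝ × ℝ} (hp : p ∈ planeSq) : projSq p = (⟨p.1, hp.1⟩, ⟨p.2, hp.2⟩) := by
  simp only [projSq]
  rw [projIcc_of_mem zero_le_one hp.1, projIcc_of_mem zero_le_one hp.2]

lemma projSq_coe (q : unitInterval × unitInterval) : projSq ((q.1 : ℝ), (q.2 : ℝ)) = q := by
  simp [projSq]

lemma coe_mem_planeSq (q : unitInterval × unitInterval) : ((q.1 : ℝ), (q.2 : ℝ)) ∈ planeSq :=
  ⟨q.1.2, q.2.2⟩

lemma projSq_injOn : InjOn projSq planeSq := by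
  intro p hp q hq h
  rw [projSq_of hp, projSq_of hq, Prod.mk.injEq, Subtype.mk.injEq, Subtype.mk.injEq] at h
  exact Prod.ext h.1 h.2

lemma isCompact_planeSq : IsCompact planeSq := isCompact_Icc.prod isCompact_Icc

/-- The interior case when the point is accessible from the left side. -/
lemma left_case {S : Type*} [MetricSpace S] [CompactSpace S] (K : Set S) (hK : IsClosed K)
    (φ : unitInterval × unitInterval → S) (hφ : IsEmbedding φ)
    (ha : K ∩ (φ '' {q | q.1 = 0 ∨ q.1 = 1 ∨ q.2 = 0 ∨ q.2 = 1}) ⊆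
        (φ '' {q | q.2 = 0}) ∪ (φ '' {q | q.2 = 1}))
    (Q : ℕ → Set S) (hQd : ∀ m n, m ≠ n → Q m ≠ Q n)
    (hQ : ∀ n, ∃ z ∈ K ∩ Set.range φ, Q n = connectedComponentIn (K ∩ Set.range φ) z)
    (hQm : ∀ n, (Q n ∩ φ '' {q | q.2 = 0}).Nonempty)
    (Qinf : Set S) (hQc : IsCompact Qinf)
    (hlim : Tendsto (fun n => hausdorffDist (Q n) Qinf) atTop (𝓝 0))
    (ζ w : ℝ × ℝ) (hζ : φ (projSq ζ) ∈ Qinf) (ε : ℝ)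
    (hball : ball ζ ε ⊆ Ioo 0 1 ×ˢ Ioo 0 1) (hw : w ∈ ball ζ ε)
    (γ : Path ((0 : ℝ), (3/4 : ℝ)) w) (hγ : ∀ t, γ t ∈ planeSq ∧ φ (projSq (γ t)) ∉ Qinf) :
    ∃ u ∈ φ '' {q | q.2 = 0}, u ∈ Qinf ∧ ∃ v, (u, v) ∈ schonfliesRel K ∧
      ∃ p ∈ closedBall ζ ε, φ (projSq p) = v := by
  set Φ : ℝ × ℝ → S := fun p => φ (projSq p) with hΦ
  have hΦc : Continuous Φ := hφ.continuous.comp continuous_projSq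
  have hΦi : InjOn Φ planeSq := fun p hp q hq h => projSq_injOn hp hq (hφ.injective h)
  have hne : Qinf.Nonempty := ⟨_, hζ⟩
  have hQne : ∀ n, (Q n).Nonempty := fun n => (hQm n).mono inter_subset_left
  have hrc : IsCompact (range φ) := isCompact_range hφ.continuous
  have hQcl : ∀ n, IsClosed (Q n) := fun n => by
    obtain ⟨z, -, hz⟩ := hQ n
    rw [hz]; exact isClosed_connComp (hK.inter hrc.isClosed) z
  have hQpre : ∀ n, IsPreconnected (Q n) := fun n => by
    obtain ⟨z, -, hz⟩ := hQ n
    rw [hz]; exact isPreconnected_connectedComponentIn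
  have hQsub : ∀ n, Q n ⊆ K ∩ range φ := fun n => by
    obtain ⟨z, -, hz⟩ := hQ n
    rw [hz]; exact connectedComponentIn_subset _ _
  have hQeq : ∀ n, ∀ u ∈ Q n, Q n = connectedComponentIn (K ∩ range φ) u := fun n u hu => by
    obtain ⟨z, -, hz⟩ := hQ n
    rw [hz] at hu ⊢; exact connectedComponentIn_eq hu
  have hside : ∀ q : unitInterval × unitInterval, (q.1 = 0 ∨ q.1 = 1) → φ q ∈ K →
      q.2 = 0 ∨ q.2 = 1 := by
    intro q hq hqK
    rcases ha ⟨hqK, q, by rcases hq with h | h <;> simp [h], rfl⟩ with ⟨q', hq', he⟩ | ⟨q', hq', he⟩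
    · rw [← hφ.injective he]; exact Or.inl hq'
    · rw [← hφ.injective he]; exact Or.inr hq'
  have hlS : ((0:ℝ), (3/4:ℝ)) ∈ planeSq := by
    refine ⟨⟨?_, ?_⟩, ?_, ?_⟩ <;> norm_num
  have hl : Φ (0, 3/4) ∉ K := by
    intro hcon
    simp only [hΦ] at hcon
    rw [projSq_of hlS] at hcon
    have := hside _ (Or.inl (Subtype.ext rfl)) hcon
    rcases this with h | h
    · have := congrArg Subtype.val h
      norm_num at this
    · have := congrArg Subtype.val h
      norm_num at this
  obtain ⟨r, hr, hrK⟩ := Metric.isOpen_iff.1 (hK.isOpen_compl.preimage hΦc) _ hl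
  set δ := min (1/8) (r/2) with hδ
  have hδ0 : 0 < δ := by rw [hδ]; positivity
  have hδ1 : δ ≤ 1/8 := min_le_left _ _
  have hδr : δ < r := (min_le_right _ _).trans_lt (by linarith)
  obtain ⟨a, ha0, haδ, η, hη, h, hhζ, hhO⟩ := exists_push (fun p => infDist (Φ p) Qinf)
    ((continuous_infDist_pt _).comp hΦc) ζ w ε hball hw γ
    (fun t => ⟨(hγ t).1, (hQc.isClosed.notMem_iff_infDist_pos hne).1 (hγ t).2⟩) δ hδ0
  obtain ⟨Ψ, hΨc, hΨi, hΨm, hΨs, hΨb, hΨl, hΨr, hΨt⟩ := exists_notch δ hδ0 hδ1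
  have hIoo : Ioo (0:ℝ) 1 ×ˢ Ioo (0:ℝ) 1 ⊆ planeSq := prod_mono Ioo_subset_Icc_self
    Ioo_subset_Icc_self
  have hhS : ∀ p ∈ planeSq, h p ∈ planeSq := by
    intro p hp
    by_contra hcon
    have h1 : h (h p) = h p := by
      by_contra h2
      exact hcon (hIoo (hhO _ h2).1)
    rw [h.injective h1] at hcon
    exact hcon hp
  have hhS' : ∀ p ∈ planeSq, ∃ q ∈ planeSq, h q = p := by
    intro p hp
    refine ⟨h.symm p, ?_, h.apply_symm_apply p⟩
    by_contra hcon
    have h1 : h (h.symm p) = h.symm p := by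
      by_contra h2
      exact hcon (hIoo (hhO _ h2).1)
    rw [h.apply_symm_apply] at h1
    rw [← h1] at hcon
    exact hcon hp
  have hhb : ∀ p : ℝ × ℝ, (p.1 = 0 ∨ p.1 = 1 ∨ p.2 = 0) → h p = p := by
    intro p hp
    by_contra h2
    obtain ⟨⟨⟨h3, h4⟩, h5, h6⟩, -⟩ := hhO _ h2
    rcases hp with hp | hp | hp
    · rw [hp] at h3; exact lt_irrefl _ h3
    · rw [hp] at h4; exact lt_irrefl _ h4
    · rw [hp] at h5; exact lt_irrefl _ h5
  have hΦhi : ∀ p ∈ planeSq, ∀ q ∈ planeSq, Φ (h p) = Φ (h q) → p = q := fun p hp q hq he =>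
    h.injective (hΦi (hhS p hp) (hhS q hq) he)
  set φ' : unitInterval × unitInterval → S := fun q => Φ (h (Ψ q)) with hφ'
  have hφ'c : Continuous φ' := hΦc.comp (h.continuous.comp hΨc)
  have hφ'i : Function.Injective φ' := fun p q he =>
    hΨi (hΦhi _ (hΨm p).1 _ (hΨm q).1 he)
  have hφ'e : IsEmbedding φ' := (hφ'c.isClosedEmbedding hφ'i).isEmbedding
  have hUc : IsCompact (range φ') := isCompact_range hφ'c
  have hbot : ∀ s : unitInterval, φ' (s, 0) = φ (s, 0) := by
    intro s
    simp only [hφ', hΦ]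
    rw [hΨb, hhb _ (Or.inr (Or.inr rfl))]
    exact congrArg φ (projSq_coe (s, 0))
  have hbot' : φ' '' {q | q.2 = 0} = φ '' {q | q.2 = 0} := by
    ext z
    constructor
    · rintro ⟨⟨s, t⟩, ht, rfl⟩
      have ht : t = 0 := ht
      subst ht
      exact ⟨(s, 0), rfl, (hbot s).symm⟩
    · rintro ⟨⟨s, t⟩, ht, rfl⟩
      have ht : t = 0 := ht
      subst ht
      exact ⟨(s, 0), rfl, hbot s⟩
  have hside' : K ∩ (φ' '' {q | q.1 = 0 ∨ q.1 = 1 ∨ q.2 = 0 ∨ q.2 = 1}) ⊆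
        (φ' '' {q | q.2 = 0}) ∪ (φ' '' {q | q.2 = 1}) := by
    rintro _ ⟨hzK, ⟨s, t⟩, hq, rfl⟩
    rcases hq with hs | hs | ht | ht
    · left
      have hs : s = 0 := hs
      subst hs
      simp only [hφ', hΦ] at hzK
      rw [hΨl, hhb _ (Or.inl rfl)] at hzK
      have hm : ((0:ℝ), (t:ℝ)/2) ∈ planeSq :=
        ⟨⟨le_rfl, zero_le_one⟩, by linarith [t.2.1], by linarith [t.2.2]⟩
      rw [projSq_of hm] at hzK
      have ht : t = 0 := by
        rcases hside _ (Or.inl (Subtype.ext rfl)) hzK with h1 | h1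
        · have := congrArg Subtype.val h1
          apply Subtype.ext
          simp only [Icc.coe_zero] at this ⊢
          linarith
        · have := congrArg Subtype.val h1
          simp only [Icc.coe_one] at this
          linarith [t.2.2]
      exact ⟨(0, t), ht, rfl⟩
    · have hs : s = 1 := hs
      subst hs
      have h1 : φ' (1, t) = φ (1, t) := by
        simp only [hφ', hΦ]
        rw [hΨr, hhb _ (Or.inr (Or.inl rfl))]
        exact congrArg φ (projSq_coe (1, t))
      rw [h1] at hzK
      rcases hside _ (Or.inr rfl) hzK with h2 | h2
      · exact Or.inl ⟨(1, t), h2, rfl⟩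
      · exact Or.inr ⟨(1, t), h2, rfl⟩
    · exact Or.inl ⟨(s, t), ht, rfl⟩
    · exact Or.inr ⟨(s, t), ht, rfl⟩
  have hzU : Φ ζ ∉ range φ' := by
    rintro ⟨q, hq⟩
    simp only [hφ'] at hq
    rw [← hhζ] at hq
    have hp : ((a:ℝ), (3/4:ℝ)) ∈ planeSq := by
      refine ⟨⟨?_, ?_⟩, ?_, ?_⟩ <;> simp only <;> linarith
    have h1 := hΦhi _ (hΨm q).1 _ hp hq
    have h2 := (hΨm q).2
    rw [h1] at h2
    simp at h2
    linarith
  obtain ⟨ρ, hρ, hρU⟩ := Metric.isOpen_iff.1 hUc.isClosed.isOpen_compl _ hzU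
  set T : Set (ℝ × ℝ) := planeSq ∩ {p | p.1 ≤ δ - |p.2 - 3/4|} with hT
  have hTc : IsCompact T := isCompact_planeSq.inter_right
    (isClosed_le (by fun_prop) (by fun_prop))
  have hTcl : IsClosed ((fun p => Φ (h p)) '' T) :=
    (hTc.image (hΦc.comp h.continuous)).isClosed
  have hcover : ∀ n, Q n \ range φ' ⊆ (fun p => Φ (h p)) '' T := by
    rintro n z ⟨hz, hzU⟩
    obtain ⟨q, rfl⟩ := (hQsub n hz).2
    obtain ⟨p, hp, hpe⟩ := hhS' _ (coe_mem_planeSq q)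
    have hpz : Φ (h p) = φ q := by
      simp only [hΦ]
      rw [hpe, projSq_coe]
    refine ⟨p, ⟨hp, ?_⟩, hpz⟩
    by_contra hcon
    rw [Set.mem_ofPred_eq, not_le] at hcon
    obtain ⟨q', hq'⟩ := hΨs p hp hcon.le
    exact hzU ⟨q', by simp only [hφ']; rw [hq', hpz]⟩
  have hgood : ∀ᶠ n in atTop, ∃ u v : S, u ∈ Q n ∧ u ∈ φ '' {q | q.2 = 0} ∧ v ∈ Q n ∧
      v ∈ connectedComponentIn (K ∩ range φ') u ∧ v ∈ φ' '' {q | q.2 = 1} ∧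
      v ∈ Φ '' closedBall ζ ε := by
    filter_upwards [haus_near hQne hne hlim hη, haus_near hQne hne hlim hρ] with n h1 h2
    obtain ⟨u, huQ, hub⟩ := hQm n
    obtain ⟨w', hw', hwd⟩ := h2.2 _ hζ
    have huU : u ∈ range φ' := by
      rw [← hbot'] at hub
      exact image_subset_range _ _ hub
    obtain ⟨v, hv, hvc⟩ := boundary_bumping (Q n) (range φ') (hQcl n).isCompact (hQpre n)
      hUc.isClosed u w' ⟨huQ, huU⟩ ⟨hw', hρU hwd⟩
    have hvT := closure_minimal (hcover n) hTcl hvc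
    obtain ⟨d, hd, hdv⟩ := hvT
    have hvQ := (connectedComponentIn_subset _ _ hv).1
    obtain ⟨q, hq⟩ := (connectedComponentIn_subset _ _ hv).2
    have hdq : Ψ q = d := hΦhi _ (hΨm q).1 _ hd.1 (hq.trans hdv.symm)
    have hdβ : δ - |d.2 - 3/4| = d.1 := le_antisymm (by rw [← hdq]; exact (hΨm q).2) hd.2
    refine ⟨u, v, huQ, hub, hvQ, ?_, ?_, ?_⟩
    · exact connectedComponentIn_mono u
        (inter_subset_inter_left _ ((hQsub n).trans inter_subset_left)) hv
    · obtain ⟨q', hq', hqd⟩ := hΨt d hd.1 hdβ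
      exact ⟨q', hq', by simp only [hφ']; rw [hqd]; exact hdv⟩
    · refine ⟨h d, ?_, hdv⟩
      have hdl : d ∈ ball ((0:ℝ), (3/4:ℝ)) r := by
        rw [mem_ball, Prod.dist_eq, max_lt_iff, Real.dist_eq, Real.dist_eq]
        have h3 := hd.1.1.1
        have h4 := abs_nonneg (d.2 - 3/4)
        simp only
        rw [sub_zero, abs_of_nonneg h3]
        constructor <;> linarith
      have hdK : Φ d ∉ K := hrK hdl
      have hhd : h d ≠ d := by
        intro hcon
        simp only at hdv
        rw [hcon] at hdv
        rw [hdv] at hdK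
        exact hdK (hQsub n hvQ).1
      rcases (hhO (h d) (fun hcon => hhd (h.injective hcon))).2 with h5 | h5
      · exact mem_closedBall.2 h5.le
      · exfalso
        obtain ⟨z, hz, hzd⟩ := h1.1 v hvQ
        have h6 := infDist_le_dist_of_mem (x := v) hz
        have h5 : η < infDist (Φ (h d)) Qinf := h5
        simp only at hdv
        rw [hdv] at h5
        linarith
  obtain ⟨N, hN⟩ := eventually_atTop.1 hgood
  choose u v huQ hub hvQ hvP hvt hvζ using fun n : ℕ => hN (n + N) (Nat.le_add_left N n)
  have huK : ∀ n, u n ∈ K ∩ range φ' := fun n => by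
    refine ⟨(hQsub _ (huQ n)).1, ?_⟩
    have := hub n
    rw [← hbot'] at this
    exact image_subset_range _ _ this
  let P : ℕ → TopologicalSpace.NonemptyCompacts S := fun n =>
    ⟨⟨connectedComponentIn (K ∩ range φ') (u n),
      (isClosed_connComp (hK.inter hUc.isClosed) _).isCompact⟩,
      ⟨u n, mem_connectedComponentIn (huK n)⟩⟩
  have hPc : ∀ n, (P n : Set S) = connectedComponentIn (K ∩ range φ') (u n) := fun n => rfl
  have huP : ∀ n, u n ∈ (P n : Set S) := fun n => mem_connectedComponentIn (huK n)
  have hPconn : ∀ n, IsConnected (P n : Set S) := fun n =>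
    ⟨⟨_, huP n⟩, isPreconnected_connectedComponentIn⟩
  have hPQ : ∀ n, (P n : Set S) ⊆ Q (n + N) := by
    intro n
    rw [hQeq _ _ (huQ n)]
    refine (hPconn n).isPreconnected.subset_connectedComponentIn (huP n) ?_
    refine (connectedComponentIn_subset _ _).trans (inter_subset_inter_right _ ?_)
    rintro _ ⟨q, rfl⟩
    exact ⟨_, rfl⟩
  have hPd : ∀ m n, m ≠ n → (P m : Set S) ≠ P n := by
    intro m n hmn he
    have h1 : u m ∈ Q (n + N) := hPQ n (he ▸ huP m)
    have h2 : Q (m + N) = Q (n + N) := by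
      rw [hQeq _ _ (huQ m), hQeq _ _ h1]
    exact hQd _ _ (by omega) h2
  obtain ⟨⟨L, u', v'⟩, -, sb, hsb, hconv⟩ := (isCompact_univ (X :=
    TopologicalSpace.NonemptyCompacts S × S × S)).tendsto_subseq
    (x := fun n => (P n, u n, v n)) (fun n => mem_univ _)
  have hcP : Tendsto (fun n => P (sb n)) atTop (𝓝 L) := (continuous_fst.tendsto _).comp hconv
  have hcu : Tendsto (fun n => u (sb n)) atTop (𝓝 u') :=
    ((continuous_fst.comp continuous_snd).tendsto _).comp hconv
  have hcv : Tendsto (fun n => v (sb n)) atTop (𝓝 v') :=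
    ((continuous_snd.comp continuous_snd).tendsto _).comp hconv
  have hPlim : Tendsto (fun n => hausdorffDist (P (sb n) : Set S) L) atTop (𝓝 0) := by
    have := tendsto_iff_dist_tendsto_zero.1 hcP
    simpa only [Metric.NonemptyCompacts.dist_eq] using this
  have hLcl : IsClosed (L : Set S) := L.isCompact.isClosed
  have hPne : ∀ n, ((P (sb n) : Set S)).Nonempty := fun n => (P (sb n)).nonempty
  have hu'L := haus_mem hPne L.nonempty hLcl hPlim (fun n => huP (sb n)) hcu
  have hv'L := haus_mem hPne L.nonempty hLcl hPlim (fun n => hvP (sb n)) hcv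
  have hbcl : IsClosed (φ '' {q | q.2 = 0}) :=
    ((isClosed_eq continuous_snd continuous_const).isCompact.image hφ.continuous).isClosed
  have htcl : IsClosed (φ' '' {q | q.2 = 1}) :=
    ((isClosed_eq continuous_snd continuous_const).isCompact.image hφ'c).isClosed
  have hζcl : IsClosed (Φ '' closedBall ζ ε) :=
    ((isCompact_closedBall ζ ε).image hΦc).isClosed
  have hu'b := hbcl.mem_of_tendsto hcu (Eventually.of_forall fun n => hub (sb n))
  have hu'K := hK.mem_of_tendsto hcu (Eventually.of_forall fun n => (huK (sb n)).1)
  have hv't := htcl.mem_of_tendsto hcv (Eventually.of_forall fun n => hvt (sb n))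
  have hv'K := hK.mem_of_tendsto hcv (Eventually.of_forall fun n => (hQsub _ (hvQ (sb n))).1)
  have hv'ζ := hζcl.mem_of_tendsto hcv (Eventually.of_forall fun n => hvζ (sb n))
  have hQinfu : u' ∈ Qinf := by
    have hsub : Tendsto (fun n => sb n + N) atTop atTop :=
      tendsto_atTop_mono (fun n => Nat.le_add_right _ _) hsb.tendsto_atTop
    exact haus_mem (A := fun n => Q (sb n + N)) (fun n => hQne _) hne hQc.isClosed
      (hlim.comp hsub) (fun n => huQ (sb n)) hcu
  refine ⟨u', hu'b, hQinfu, v', ⟨hu'K, hv'K, Or.inr ⟨φ', hφ'e, hbot' ▸ hu'b, hv't, hside',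
    fun n => P (sb n), ?_, ?_, ?_, L, L.isCompact, ?_, hPlim, hu'L, hv'L⟩⟩, hv'ζ⟩
  · intro m n hmn
    exact hPd _ _ (fun h => hmn (hsb.injective h))
  · intro n
    exact ⟨u (sb n), huK _, rfl⟩
  · intro n
    exact ⟨⟨u (sb n), huP _, hbot' ▸ hub _⟩, ⟨v (sb n), hvP _, hvt _⟩⟩
  · exact limit_connected (fun n => P (sb n)) L (fun n => hPconn _) hcP

/-- The copy in the plane of the preimage of a subset of a quadrilateral. -/
lemma plane_copy {S : Type*} [MetricSpace S] (φ : unitInterval × unitInterval → S)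
    (hφ : IsEmbedding φ) (A : Set S) (hA : IsPreconnected A) (hAc : IsClosed A)
    (hAr : A ⊆ range φ) :
    IsPreconnected (planeSq ∩ (fun p => φ (projSq p)) ⁻¹' A) ∧
      IsClosed (planeSq ∩ (fun p => φ (projSq p)) ⁻¹' A) := by
  constructor
  · have h1 : IsPreconnected (φ ⁻¹' A) := by
      rw [← hφ.isInducing.isPreconnected_image, image_preimage_eq_of_subset hAr]
      exact hA
    have h2 := h1.image (fun q : unitInterval × unitInterval => ((q.1 : ℝ), (q.2 : ℝ)))
      (by fun_prop)
    convert h2 using 1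
    ext p
    constructor
    · rintro ⟨hp, hpA⟩
      refine ⟨projSq p, hpA, ?_⟩
      rw [projSq_of hp]
    · rintro ⟨q, hq, rfl⟩
      refine ⟨coe_mem_planeSq q, ?_⟩
      show φ (projSq _) ∈ A
      rw [projSq_coe]; exact hq
  · exact isCompact_planeSq.isClosed.inter
      (hAc.preimage (hφ.continuous.comp continuous_projSq))

lemma projSq_flip (p : ℝ × ℝ) :
    projSq (1 - p.1, p.2) = (unitInterval.symm (projSq p).1, (projSq p).2) := by
  simp [projSq, unitInterval.symm_projIcc]

lemma interior_case {S : Type*} [MetricSpace S] [CompactSpace S] (K : Set S) (hK : IsClosed K)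
    (φ : unitInterval × unitInterval → S) (hφ : IsEmbedding φ)
    (ha : K ∩ (φ '' {q | q.1 = 0 ∨ q.1 = 1 ∨ q.2 = 0 ∨ q.2 = 1}) ⊆
        (φ '' {q | q.2 = 0}) ∪ (φ '' {q | q.2 = 1}))
    (Q : ℕ → Set S) (hQd : ∀ m n, m ≠ n → Q m ≠ Q n)
    (hQ : ∀ n, ∃ z ∈ K ∩ Set.range φ, Q n = connectedComponentIn (K ∩ Set.range φ) z)
    (hQm : ∀ n, (Q n ∩ φ '' {q | q.2 = 0}).Nonempty)
    (hQm' : ∀ n, (Q n ∩ φ '' {q | q.2 = 1}).Nonempty)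
    (Qinf : Set S) (hQc : IsCompact Qinf) (hQi : IsPreconnected Qinf)
    (hQinf : Qinf ⊆ K ∩ range φ)
    (hlim : Tendsto (fun n => hausdorffDist (Q n) Qinf) atTop (𝓝 0))
    (ζ : ℝ × ℝ) (hζ : φ (projSq ζ) ∈ Qinf) (ε : ℝ) (hε : 0 < ε)
    (hball : ball ζ ε ⊆ Ioo 0 1 ×ˢ Ioo 0 1) :
    ∃ u ∈ φ '' {q | q.2 = 0}, u ∈ Qinf ∧ ∃ v, (u, v) ∈ schonfliesRel K ∧
      ∃ p ∈ closedBall ζ ε, φ (projSq p) = v := by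
  have hne : Qinf.Nonempty := ⟨_, hζ⟩
  have hQne : ∀ n, (Q n).Nonempty := fun n => (hQm n).mono inter_subset_left
  have hrc : IsCompact (range φ) := isCompact_range hφ.continuous
  have hQcl : ∀ n, IsClosed (Q n) := fun n => by
    obtain ⟨z, -, hz⟩ := hQ n
    rw [hz]; exact isClosed_connComp (hK.inter hrc.isClosed) z
  have hQpre : ∀ n, IsPreconnected (Q n) := fun n => by
    obtain ⟨z, -, hz⟩ := hQ n
    rw [hz]; exact isPreconnected_connectedComponentIn
  have hQsub : ∀ n, Q n ⊆ K ∩ range φ := fun n => by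
    obtain ⟨z, -, hz⟩ := hQ n
    rw [hz]; exact connectedComponentIn_subset _ _
  have hQeq : ∀ n, ∀ u ∈ Q n, Q n = connectedComponentIn (K ∩ range φ) u := fun n u hu => by
    obtain ⟨z, -, hz⟩ := hQ n
    rw [hz] at hu ⊢; exact connectedComponentIn_eq hu
  have hside : ∀ q : unitInterval × unitInterval, (q.1 = 0 ∨ q.1 = 1) → φ q ∈ K →
      q.2 = 0 ∨ q.2 = 1 := by
    intro q hq hqK
    rcases ha ⟨hqK, q, by rcases hq with h | h <;> simp [h], rfl⟩ with ⟨q', hq', he⟩ | ⟨q', hq', he⟩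
    · rw [← hφ.injective he]; exact Or.inl hq'
    · rw [← hφ.injective he]; exact Or.inr hq'
  set Φ : ℝ × ℝ → S := fun p => φ (projSq p) with hΦ
  have hΦc : Continuous Φ := hφ.continuous.comp continuous_projSq
  have hΦi : InjOn Φ planeSq := fun p hp q hq h => projSq_injOn hp hq (hφ.injective h)
  have hIoo : Ioo (0:ℝ) 1 ×ˢ Ioo (0:ℝ) 1 ⊆ planeSq := prod_mono Ioo_subset_Icc_self
    Ioo_subset_Icc_self
  have hdis : ∀ᶠ n in atTop, Disjoint (Q n) Qinf := by
    by_cases hex : ∃ k, ¬ Disjoint (Q k) Qinf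
    · obtain ⟨k, hk⟩ := hex
      filter_upwards [eventually_gt_atTop k] with n hn
      by_contra hcon
      obtain ⟨z1, h1, h1'⟩ := Set.not_disjoint_iff.1 hk
      obtain ⟨z2, h2, h2'⟩ := Set.not_disjoint_iff.1 hcon
      have h3 : z2 ∈ Q k := by
        rw [hQeq k z1 h1]
        exact hQi.subset_connectedComponentIn h1' hQinf h2'
      exact hQd k n hn.ne ((hQeq k z2 h3).trans (hQeq n z2 h2).symm)
    · push Not at hex
      exact Eventually.of_forall hex
  have hBc : IsCompact (planeSq \ ball ζ ε) := isCompact_planeSq.diff isOpen_ball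
  have hzB : Φ ζ ∉ Φ '' (planeSq \ ball ζ ε) := by
    rintro ⟨p, hp, he⟩
    have := hΦi hp.1 (hIoo (hball (mem_ball_self hε))) he
    rw [this] at hp
    exact hp.2 (mem_ball_self hε)
  obtain ⟨ρ, hρ, hρU⟩ := Metric.isOpen_iff.1 (hBc.image hΦc).isClosed.isOpen_compl _ hzB
  obtain ⟨k, hk, -, hk2⟩ := (hdis.and (haus_near hQne hne hlim hρ)).exists
  obtain ⟨w', hw', hwd⟩ := hk2 _ hζ
  obtain ⟨qw, rfl⟩ := (hQsub k hw').2
  set w : ℝ × ℝ := ((qw.1 : ℝ), (qw.2 : ℝ)) with hwdef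
  have hΦw : Φ w = φ qw := congrArg φ (projSq_coe qw)
  have hwb : w ∈ ball ζ ε := by
    by_contra hcon
    exact hρU hwd ⟨w, ⟨coe_mem_planeSq qw, hcon⟩, hΦw⟩
  obtain ⟨hE1, hE2⟩ := plane_copy φ hφ (Q k) (hQpre k) (hQcl k)
    ((hQsub k).trans inter_subset_right)
  obtain ⟨hZ1, hZ2⟩ := plane_copy φ hφ Qinf hQi hQc.isClosed (hQinf.trans inter_subset_right)
  obtain ⟨_, hb1, ⟨q0, hq0, rfl⟩⟩ := hQm k
  obtain ⟨_, ht1, ⟨q1, hq1, rfl⟩⟩ := hQm' k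
  have hcE : ∀ q, φ q ∈ Q k → ((q.1 : ℝ), (q.2 : ℝ)) ∈ planeSq ∩ Φ ⁻¹' (Q k) := by
    intro q hq
    refine ⟨coe_mem_planeSq q, ?_⟩
    show φ (projSq _) ∈ Q k
    rwa [projSq_coe]
  have hq0 : q0.2 = 0 := hq0
  have hq1 : q1.2 = 1 := hq1
  have hoff : ∀ x : ℝ, (x = 0 ∨ x = 1) →
      (x, (3/4:ℝ)) ∈ planeSq ∧ (x, (3/4:ℝ)) ∉ planeSq ∩ Φ ⁻¹' (Q k) := by
    intro x hx
    have hm : (x, (3/4:ℝ)) ∈ planeSq := by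
      rcases hx with rfl | rfl <;> refine ⟨⟨?_, ?_⟩, ?_, ?_⟩ <;> norm_num
    refine ⟨hm, fun hcon => ?_⟩
    have h1 : φ (projSq (x, 3/4)) ∈ K := (hQsub k hcon.2).1
    rw [projSq_of hm] at h1
    have h2 := hside _ (by
      rcases hx with hx | hx
      · left; exact Subtype.ext hx
      · right; exact Subtype.ext hx) h1
    rcases h2 with h | h
    · have := congrArg Subtype.val h
      norm_num at this
    · have := congrArg Subtype.val h
      norm_num at this
  rcases exists_access (planeSq ∩ Φ ⁻¹' (Q k)) (planeSq ∩ Φ ⁻¹' Qinf) hE1 hE2 inter_subset_left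
    hZ1 hZ2 inter_subset_left
    (by
      rw [Set.disjoint_left]
      intro p hp hp'
      exact Set.disjoint_left.1 hk hp.2 hp'.2)
    _ _ (hcE q0 hb1) (hcE q1 ht1) (by simp [hq0]) (by simp [hq1]) (0, 3/4) (1, 3/4)
    (hoff 0 (Or.inl rfl)).1 (hoff 1 (Or.inr rfl)).1 rfl rfl (hoff 0 (Or.inl rfl)).2
    (hoff 1 (Or.inr rfl)).2 w (hcE qw hw') with ⟨γ, hγ⟩ | ⟨γ, hγ⟩
  · exact left_case K hK φ hφ ha Q hQd hQ hQm Qinf hQc hlim ζ w hζ ε hball hwb γ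
      (fun t => ⟨(hγ t).1, fun hcon => (hγ t).2 ⟨(hγ t).1, hcon⟩⟩)
  · let fl : unitInterval × unitInterval ≃ₜ unitInterval × unitInterval :=
      unitInterval.symmHomeomorph.prodCongr (Homeomorph.refl _)
    have hfl : ∀ q, fl q = (unitInterval.symm q.1, q.2) := fun q => rfl
    have hfl2 : ∀ q, fl (fl q) = q := fun q => by rw [hfl, hfl]; simp
    set phiB := φ ∘ fl with hphiB
    have hphiB_emb : IsEmbedding phiB := hφ.comp fl.isEmbedding
    have hr2 : range phiB = range φ := by
      rw [hphiB, fl.surjective.range_comp]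
    have him : ∀ A : Set (unitInterval × unitInterval), (∀ q, fl q ∈ A ↔ q ∈ A) →
        phiB '' A = φ '' A := by
      intro A hA
      ext z
      constructor
      · rintro ⟨q, hq, rfl⟩
        exact ⟨fl q, (hA q).2 hq, rfl⟩
      · rintro ⟨q, hq, rfl⟩
        exact ⟨fl q, (hA q).2 hq, congrArg φ (hfl2 q)⟩
    have hi0 := him {q | q.2 = 0} (fun q => Iff.rfl)
    have hi1 := him {q | q.2 = 1} (fun q => Iff.rfl)
    have hi2 := him {q | q.1 = 0 ∨ q.1 = 1 ∨ q.2 = 0 ∨ q.2 = 1} (fun q => by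
      rw [hfl]
      simp only [Set.mem_ofPred_eq, unitInterval.symm_eq_zero, unitInterval.symm_eq_one]
      tauto)
    let f : ℝ × ℝ → ℝ × ℝ := fun p => (1 - p.1, p.2)
    have hfc : Continuous f := by simp only [f]; fun_prop
    have hff : ∀ p, f (f p) = p := fun p => by simp [f]
    have hfd : ∀ p q, dist (f p) (f q) = dist p q := fun p q => by
      simp only [f, Prod.dist_eq]
      congr 1
      rw [Real.dist_eq, Real.dist_eq, abs_sub_comm]
      congr 1
      ring
    have hfφ : ∀ p, phiB (projSq (f p)) = φ (projSq p) := fun p => by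
      simp only [f, hphiB, Function.comp]
      rw [projSq_flip, hfl]; simp
    have hfS : ∀ p, p ∈ planeSq → f p ∈ planeSq := by
      rintro p ⟨⟨h1, h2⟩, h3⟩
      exact ⟨⟨by simp only [f]; linarith, by simp only [f]; linarith⟩, h3⟩
    have hres := left_case K hK phiB hphiB_emb (by rw [hi0, hi1, hi2]; exact ha) Q hQd
      (by rw [hr2]; exact hQ) (by rw [hi0]; exact hQm) Qinf hQc hlim (f ζ) (f w)
      (by rw [hfφ]; exact hζ) ε
      (by
        intro p hp
        have h1 : f p ∈ ball ζ ε := by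
          rw [mem_ball, ← hfd, hff]; exact hp
        obtain ⟨⟨h2, h3⟩, h4⟩ := hball h1
        simp only [f] at h2 h3 h4
        exact ⟨⟨by linarith, by linarith⟩, h4⟩)
      (by rw [mem_ball, hfd]; exact hwb)
      ((γ.map hfc).cast (by simp [f]) rfl)
      (fun t => ⟨hfS _ (hγ t).1, fun hcon => (hγ t).2 ⟨(hγ t).1, by
        have h1 : phiB (projSq (f (γ t))) ∈ Qinf := hcon
        rw [hfφ] at h1
        exact h1⟩⟩)
    rw [hi0] at hres
    obtain ⟨u, hu, hu', v, huv, p, hp, hpv⟩ := hres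
    refine ⟨u, hu, hu', v, huv, f p, ?_, ?_⟩
    · rw [mem_closedBall, ← hfd, hff]; exact hp
    · rw [← hpv, ← hfφ, hff]

/-! ### The equivalence relation -/

lemma schonfliesEquiv_mem {S : Type*} [MetricSpace S] (K : Set S) (hK : IsClosed K) :
    schonfliesEquiv K ∈ closedEquivsOn K (schonfliesRel K) := by
  refine ⟨?_, ?_, ?_, ?_, ?_, ?_⟩
  · exact subset_sInter fun E hE => hE.1
  · refine sInter_subset_of_mem ?_
    refine ⟨fun p hp => ⟨hp.1, hp.2.1⟩, Subset.rfl, hK.prod hK, fun x hx => ⟨hx, hx⟩,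
      fun x y h => ⟨h.2, h.1⟩, fun x y z h h' => ⟨h.1, h'.2⟩⟩
  · exact isClosed_sInter fun E hE => hE.2.2.1
  · intro x hx E hE
    exact hE.2.2.2.1 x hx
  · intro x y h E hE
    exact hE.2.2.2.2.1 x y (h E hE)
  · intro x y z h h' E hE
    exact hE.2.2.2.2.2 x y z (h E hE) (h' E hE)

lemma limit_subset_class {S : Type*} [MetricSpace S] [CompactSpace S] (K : Set S)
    (hK : IsClosed K) (x y : S) (hx : x ∈ K) (hy : y ∈ K)
    (φ : unitInterval × unitInterval → S) (hφ : IsEmbedding φ)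
    (hxb : x ∈ φ '' {q | q.2 = 0}) (hyt : y ∈ φ '' {q | q.2 = 1})
    (ha : K ∩ (φ '' {q | q.1 = 0 ∨ q.1 = 1 ∨ q.2 = 0 ∨ q.2 = 1}) ⊆
        (φ '' {q | q.2 = 0}) ∪ (φ '' {q | q.2 = 1}))
    (Q : ℕ → Set S) (hQd : ∀ m n, m ≠ n → Q m ≠ Q n)
    (hQ : ∀ n, ∃ z ∈ K ∩ Set.range φ, Q n = connectedComponentIn (K ∩ Set.range φ) z)
    (hQm : ∀ n, (Q n ∩ φ '' {q | q.2 = 0}).Nonempty ∧ (Q n ∩ φ '' {q | q.2 = 1}).Nonempty)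
    (Qinf : Set S) (hQc : IsCompact Qinf) (hQi : IsConnected Qinf)
    (hlim : Tendsto (fun n => hausdorffDist (Q n) Qinf) atTop (𝓝 0))
    (hxQ : x ∈ Qinf) (hyQ : y ∈ Qinf) : Qinf ⊆ schonfliesClass K x := by
  obtain ⟨hRE, -, hEc, -, hEs, hEt⟩ := schonfliesEquiv_mem K hK
  have hne : Qinf.Nonempty := ⟨x, hxQ⟩
  have hQne : ∀ n, (Q n).Nonempty := fun n => (hQm n).1.mono inter_subset_left
  have hrc : IsCompact (range φ) := isCompact_range hφ.continuous
  have hQinf : Qinf ⊆ K ∩ range φ := by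
    intro z hz
    rw [← (hK.inter hrc.isClosed).closure_eq, Metric.mem_closure_iff]
    intro ρ hρ
    obtain ⟨n, -, h2⟩ := (haus_near hQne hne hlim hρ).exists
    obtain ⟨q, hq, hqd⟩ := h2 z hz
    obtain ⟨z', -, hz'⟩ := hQ n
    rw [hz'] at hq
    exact ⟨q, connectedComponentIn_subset _ _ hq, by rw [dist_comm]; exact hqd⟩
  have hrel : ∀ u v, u ∈ Qinf → v ∈ Qinf → u ∈ φ '' {q | q.2 = 0} → v ∈ φ '' {q | q.2 = 1} →
      (u, v) ∈ schonfliesEquiv K := fun u v hu hv hu' hv' =>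
    hRE ⟨(hQinf hu).1, (hQinf hv).1, Or.inr ⟨φ, hφ, hu', hv', ha, Q, hQd, hQ, hQm, Qinf, hQc, hQi,
      hlim, hu, hv⟩⟩
  have hxy := hrel x y hxQ hyQ hxb hyt
  have hb : ∀ u ∈ Qinf, u ∈ φ '' {q | q.2 = 0} → (x, u) ∈ schonfliesEquiv K := fun u hu hu' =>
    hEt _ _ _ hxy (hEs _ _ (hrel u y hu hyQ hu' hyt))
  intro z hz
  obtain ⟨q, hq⟩ := (hQinf hz).2
  by_cases hbd : q ∈ {q : unitInterval × unitInterval | q.1 = 0 ∨ q.1 = 1 ∨ q.2 = 0 ∨ q.2 = 1}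
  · rcases ha ⟨(hQinf hz).1, q, hbd, hq⟩ with h1 | h1
    · exact hb z hz h1
    · exact hrel x z hxQ hz hxb h1
  rw [Set.mem_ofPred_eq] at hbd
  push Not at hbd
  obtain ⟨n1, n2, n3, n4⟩ := hbd
  set ζ : ℝ × ℝ := ((q.1 : ℝ), (q.2 : ℝ)) with hζ
  have hΦζ : φ (projSq ζ) = z := by rw [← hq]; exact congrArg φ (projSq_coe q)
  have hζI : ζ ∈ Ioo (0:ℝ) 1 ×ˢ Ioo (0:ℝ) 1 :=
    ⟨⟨unitInterval.pos_iff_ne_zero.2 n1, unitInterval.lt_one_iff_ne_one.2 n2⟩,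
      unitInterval.pos_iff_ne_zero.2 n3, unitInterval.lt_one_iff_ne_one.2 n4⟩
  obtain ⟨r, hr, hrI⟩ := Metric.isOpen_iff.1 (isOpen_Ioo.prod isOpen_Ioo) ζ hζI
  have hcl : IsClosed {p : ℝ × ℝ | φ (projSq p) ∈ schonfliesClass K x} := by
    have h1 : Continuous (fun p : ℝ × ℝ => (x, φ (projSq p))) :=
      continuous_const.prodMk (hφ.continuous.comp continuous_projSq)
    exact hEc.preimage h1
  have hmem : ζ ∈ {p : ℝ × ℝ | φ (projSq p) ∈ schonfliesClass K x} := by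
    rw [← hcl.closure_eq, Metric.mem_closure_iff]
    intro ε hε
    set ε' := min r (ε/2) with hε'
    have hε0 : 0 < ε' := lt_min hr (half_pos hε)
    obtain ⟨u, hu, hu', v, huv, p, hp, hpv⟩ := interior_case K hK φ hφ ha Q hQd hQ
      (fun n => (hQm n).1) (fun n => (hQm n).2) Qinf hQc hQi.isPreconnected hQinf hlim ζ
      (by rw [hΦζ]; exact hz) ε' hε0 ((ball_subset_ball (min_le_left _ _)).trans hrI)
    refine ⟨p, ?_, ?_⟩
    · show (x, φ (projSq p)) ∈ schonfliesEquiv K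
      rw [hpv]
      exact hEt _ _ _ (hb u hu' hu) (hRE huv)
    · rw [dist_comm]
      have h1 := mem_closedBall.1 hp
      have h2 : ε' ≤ ε/2 := min_le_right _ _
      linarith
  have h3 : φ (projSq ζ) ∈ schonfliesClass K x := hmem
  rwa [hΦζ] at h3

/-- For a nonempty compact subset `K` of a closed surface `S` and every
`x ∈ K`, there exists a connected set `N_x` with `R_K(x) ⊆ N_x ⊆ [x]_∼`. -/
theorem exists_connected_between_fiber_and_class
    {S : Type*} [MetricSpace S] [CompactSpace S] [ConnectedSpace S] [Nonempty S]
    (hS : IsSurfaceLocallyEuclidean S)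
    (K : Set S) (hK : IsCompact K) (hKne : K.Nonempty) :
    ∀ x ∈ K, ∃ N : Set S, IsConnected N ∧
      {y | (x, y) ∈ schonfliesRel K} ⊆ N ∧ N ⊆ schonfliesClass K x := by
  intro x hx
  have hKc := hK.isClosed
  obtain ⟨hRE, -, -, hEr, -, -⟩ := schonfliesEquiv_mem K hKc
  have hxx : x ∈ schonfliesClass K x := hEr x hx
  refine ⟨connectedComponentIn (schonfliesClass K x) x,
    isConnected_connectedComponentIn_iff.2 hxx, ?_, connectedComponentIn_subset _ _⟩
  rintro y ⟨hx', hy, h | ⟨φ, hφ, hxb, hyt, ha, Q, hQd, hQ, hQm, Qinf, hQc, hQi, hlim, hxQ, hyQ⟩⟩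
  · have h : x = y := h
    rw [← h]
    exact mem_connectedComponentIn hxx
  · exact hQi.isPreconnected.subset_connectedComponentIn hxQ
      (limit_subset_class K hKc x y hx hy φ hφ hxb hyt ha Q hQd hQ hQm Qinf hQc hQi hlim hxQ hyQ)
      hyQ
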